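/- Let A be a stationary dense closed operator on a Banach space E with n = n(A), F = closure of D(A^n), and A_F the part of A in F. Then for every k ∈ ℕ₀ one has continuous inclusions D(A^{n+k}) ↪ D(A_F^k) ↪ D(A^k); consequently D_∞(A) = D_∞(A_F) as Fréchet spaces and A_∞ = (A_F)_∞. -/

import Mathlib

open Set Finset

def dompowS {E : Type*} [AddCommGroup E] [Module ℂ E]
    (f : E →ₗ[ℂ] E) (D : Submodule ℂ E) : ℕ → Submodule ℂ E
  | 0 => ⊤
  | k + 1 => D ⊓ (dompowS f D k).comap f

def statSet {E : Type*} [NormedAddCommGroup E] [Module ℂ E]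
    (f : E →ₗ[ℂ] E) (D : Submodule ℂ E) : Set ℕ :=
  {k | ∀ m, k ≤ m → (dompowS f D m : Set E) ⊆ closure (dompowS f D (m + 1) : Set E)}

def IsClosedOp {E : Type*} [NormedAddCommGroup E] [Module ℂ E]
    (f : E →ₗ[ℂ] E) (D : Submodule ℂ E) : Prop :=
  IsClosed {p : E × E | p.1 ∈ D ∧ f p.1 = p.2}

/-- `D((A_F)^k)`: iterated domains of the part `A_F` of `A` in `F`. -/
def partDompow {E : Type*} [AddCommGroup E] [Module ℂ E]
    (f : E →ₗ[ℂ] E) (D F : Submodule ℂ E) : ℕ → Submodule ℂ E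
  | 0 => F
  | k + 1 => (D ⊓ F ⊓ F.comap f) ⊓ (partDompow f D F k).comap f

/-- The graph seminorm `p_k(x) = Σ_{j ≤ k} ‖A^j x‖`. -/
noncomputable def graphNorm {E : Type*} [NormedAddCommGroup E] [Module ℂ E]
    (f : E →ₗ[ℂ] E) (k : ℕ) (x : E) : ℝ :=
  ∑ j ∈ Finset.range (k + 1), ‖(f ^ j) x‖

theorem dompowS_succ_le {E : Type*} [AddCommGroup E] [Module ℂ E]
    (f : E →ₗ[ℂ] E) (D : Submodule ℂ E) (k : ℕ) : dompowS f D (k + 1) ≤ dompowS f D k := by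
  induction k with
  | zero => exact le_top
  | succ k ih => exact fun _ hx => ⟨hx.1, ih hx.2⟩

theorem dompowS_antitone {E : Type*} [AddCommGroup E] [Module ℂ E]
    (f : E →ₗ[ℂ] E) (D : Submodule ℂ E) : Antitone (dompowS f D) :=
  antitone_nat_of_succ_le (dompowS_succ_le f D)

theorem dompowS_add_le_partDompow {E : Type*} [AddCommGroup E] [Module ℂ E]
    (f : E →ₗ[ℂ] E) (D F : Submodule ℂ E) {n : ℕ} (hF : dompowS f D n ≤ F) (k : ℕ) :
    dompowS f D (n + k) ≤ partDompow f D F k := by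
  induction k with
  | zero => exact hF
  | succ k ih =>
    have h (m : ℕ) : dompowS f D (n + m) ≤ F :=
      (dompowS_antitone f D (Nat.le_add_right n m)).trans hF
    exact fun x hx => ⟨⟨⟨hx.1, h (k + 1) hx⟩, h k hx.2⟩, ih hx.2⟩

theorem partDompow_le_dompowS {E : Type*} [AddCommGroup E] [Module ℂ E]
    (f : E →ₗ[ℂ] E) (D F : Submodule ℂ E) (k : ℕ) : partDompow f D F k ≤ dompowS f D k := by
  induction k with
  | zero => exact le_top
  | succ k ih => exact fun _ hx => ⟨hx.1.1.1, ih hx.2⟩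

theorem graphNorm_mono {E : Type*} [NormedAddCommGroup E] [Module ℂ E]
    (f : E →ₗ[ℂ] E) (x : E) : Monotone fun k => graphNorm f k x := fun _ _ hkl =>
  Finset.sum_le_sum_of_subset_of_nonneg (Finset.range_mono (Nat.succ_le_succ hkl))
    fun _ _ _ => norm_nonneg _

/-- For a stationary dense closed operator `A`, `n = n(A)`, `F = closure(D(Aⁿ))`:
for every `k` there are continuous inclusions `D(A^{n+k}) ↪ D(A_F^k) ↪ D(A^k)`;
consequently `D_∞(A) = D_∞(A_F)` (with equivalent graph seminorms, hence as Fréchet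
spaces), and `A_∞ = (A_F)_∞` (both being the restriction of `f`). -/
theorem stmt8 {E : Type*} [NormedAddCommGroup E] [NormedSpace ℂ E] [CompleteSpace E]
    (f : E →ₗ[ℂ] E) (D : Submodule ℂ E) (hA : IsClosedOp f D)
    (hstat : (statSet f D).Nonempty)
    (n : ℕ) (hn : n = sInf (statSet f D))
    (F : Submodule ℂ E) (hF : F = (dompowS f D n).topologicalClosure) :
    (∀ k : ℕ, (dompowS f D (n + k) : Set E) ⊆ (partDompow f D F k : Set E) ∧
      ∃ C : ℝ, 0 < C ∧ ∀ x ∈ dompowS f D (n + k), graphNorm f k x ≤ C * graphNorm f (n + k) x) ∧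
    (∀ k : ℕ, (partDompow f D F k : Set E) ⊆ (dompowS f D k : Set E) ∧
      ∃ C : ℝ, 0 < C ∧ ∀ x ∈ partDompow f D F k, graphNorm f k x ≤ C * graphNorm f k x) ∧
    (⋂ k : ℕ, (dompowS f D k : Set E)) = ⋂ k : ℕ, (partDompow f D F k : Set E) := by
  have hle : dompowS f D n ≤ F := hF ▸ Submodule.le_topologicalClosure _
  have hin := dompowS_add_le_partDompow f D F hle
  have hout := partDompow_le_dompowS f D F
  refine ⟨fun k => ⟨hin k, 1, one_pos, fun x _ => ?_⟩,
    fun k => ⟨hout k, 1, one_pos, fun x _ => (one_mul _).ge⟩, ?_⟩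
  · rw [one_mul]
    exact graphNorm_mono f x (Nat.le_add_left k n)
  · exact Set.Subset.antisymm
      (Set.subset_iInter fun k => (Set.iInter_subset _ (n + k)).trans (hin k))
      (Set.iInter_mono hout)
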